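/- The Hardy operator T on L²(ℝ), given by (Tu)(x) = (1/π) ∫_0^∞ u(y)/(x+y) dy for x > 0 (with kernel H(x)H(y)/(π(x+y))), is a bounded self-adjoint operator with operator norm 1 (its spectrum is [0,1]). -/

import Mathlib

open MeasureTheory Real

lemma hd_gam {r : ℝ} (hr : 0 < r) :
    ∫⁻ t in Set.Ioi (0:ℝ), ENNReal.ofReal (t ^ (-(1/2):ℝ) * Real.exp (-(r * t)))
      = ENNReal.ofReal (√π * r ^ (-(1/2):ℝ)) := by
  have h := Real.integral_rpow_mul_exp_neg_mul_Ioi (a := 1/2) (r := r) (by norm_num) hr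
  have e : (1/2 - 1 : ℝ) = -(1/2) := by norm_num
  rw [e, Real.Gamma_one_half_eq] at h
  have hint : IntegrableOn (fun t : ℝ => t ^ (-(1/2):ℝ) * Real.exp (-(r * t))) (Set.Ioi 0) := by
    apply Integrable.of_integral_ne_zero
    rw [h]; positivity
  rw [← ofReal_integral_eq_lintegral_ofReal hint, h]
  · congr 1
    rw [Real.rpow_neg hr.le, one_div, Real.inv_rpow hr.le, mul_comm]
  · filter_upwards [ae_restrict_mem measurableSet_Ioi] with t ht
    have : (0:ℝ) < t := ht
    simp only [Pi.zero_apply]; positivity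

lemma hd_cs {α : Type*} [MeasurableSpace α] (μ : Measure α) {f g : α → ENNReal}
    (hf : AEMeasurable f μ) (hg : AEMeasurable g μ) :
    (∫⁻ a, f a * g a ∂μ) ^ 2 ≤ (∫⁻ a, f a ^ 2 ∂μ) * (∫⁻ a, g a ^ 2 ∂μ) := by
  have h := ENNReal.lintegral_mul_le_Lp_mul_Lq μ Real.HolderConjugate.two_two hf hg
  simp only [ENNReal.rpow_two, Pi.mul_apply] at h
  calc _ ≤ _ := pow_le_pow_left' h 2
    _ = _ := by
      rw [mul_pow, ← ENNReal.rpow_two, ← ENNReal.rpow_mul, ← ENNReal.rpow_two, ← ENNReal.rpow_mul]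
      norm_num

lemma hd_schur {g : ℝ → ENNReal} (hg : Measurable g) :
    ∫⁻ s in Set.Ioi (0:ℝ), (∫⁻ y in Set.Ioi (0:ℝ), ENNReal.ofReal (Real.exp (-(s * y))) * g y) ^ 2
      ≤ ENNReal.ofReal π * ∫⁻ y in Set.Ioi (0:ℝ), g y ^ 2 := by
  have key : ∀ s ∈ Set.Ioi (0:ℝ),
      (∫⁻ y in Set.Ioi (0:ℝ), ENNReal.ofReal (Real.exp (-(s * y))) * g y) ^ 2 ≤
      ENNReal.ofReal (√π * s ^ (-(1/2):ℝ)) *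
        ∫⁻ y in Set.Ioi (0:ℝ), ENNReal.ofReal (Real.exp (-(s * y)) * y ^ (1/2:ℝ)) * g y ^ 2 := by
    intro s hs
    have hs : 0 < s := hs
    have h := hd_cs (volume.restrict (Set.Ioi (0:ℝ)))
      (f := fun y => ENNReal.ofReal (y ^ (-(1/4):ℝ) * Real.exp (-(s * y) / 2)))
      (g := fun y => ENNReal.ofReal (y ^ (1/4:ℝ) * Real.exp (-(s * y) / 2)) * g y)
      (by fun_prop) (by fun_prop)
    rw [← hd_gam hs]
    convert h using 2
    · refine setLIntegral_congr_fun measurableSet_Ioi fun y hy => ?_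
      have hy : 0 < y := hy
      rw [← mul_assoc, ← ENNReal.ofReal_mul (by positivity)]
      congr 2
      rw [mul_mul_mul_comm, ← Real.exp_add, ← Real.rpow_add hy]
      norm_num
    · refine setLIntegral_congr_fun measurableSet_Ioi fun y hy => ?_
      have hy : 0 < y := hy
      rw [← ENNReal.ofReal_pow (by positivity), mul_pow, ← Real.exp_nat_mul, ← Real.rpow_mul_natCast hy.le]
      congr 3
      · norm_num
      · push_cast; ring
    · refine setLIntegral_congr_fun measurableSet_Ioi fun y hy => ?_
      have hy : 0 < y := hy
      rw [mul_pow, ← ENNReal.ofReal_pow (by positivity), mul_pow, ← Real.exp_nat_mul, ← Real.rpow_mul_natCast hy.le, mul_comm (Real.exp _)]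
      congr 4
      · norm_num
      · push_cast; ring
  calc _ ≤ ∫⁻ s in Set.Ioi (0:ℝ), ENNReal.ofReal (√π * s ^ (-(1/2):ℝ)) *
        ∫⁻ y in Set.Ioi (0:ℝ), ENNReal.ofReal (Real.exp (-(s * y)) * y ^ (1/2:ℝ)) * g y ^ 2 :=
        setLIntegral_mono' measurableSet_Ioi key
    _ = ∫⁻ s in Set.Ioi (0:ℝ), ∫⁻ y in Set.Ioi (0:ℝ), ENNReal.ofReal (√π * s ^ (-(1/2):ℝ)) *
         (ENNReal.ofReal (Real.exp (-(s * y)) * y ^ (1/2:ℝ)) * g y ^ 2) := by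
        refine lintegral_congr fun s => ?_
        rw [lintegral_const_mul _ (by fun_prop)]
    _ = ∫⁻ y in Set.Ioi (0:ℝ), ∫⁻ s in Set.Ioi (0:ℝ), ENNReal.ofReal (√π * s ^ (-(1/2):ℝ)) *
         (ENNReal.ofReal (Real.exp (-(s * y)) * y ^ (1/2:ℝ)) * g y ^ 2) := by
        rw [lintegral_lintegral_swap]
        apply Measurable.aemeasurable
        simp only [Function.uncurry_def]
        fun_prop
    _ = ∫⁻ y in Set.Ioi (0:ℝ), ENNReal.ofReal π * g y ^ 2 := by
        refine setLIntegral_congr_fun measurableSet_Ioi fun y hy => ?_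
        have hy : 0 < y := hy
        have : ∀ s ∈ Set.Ioi (0:ℝ), ENNReal.ofReal (√π * s ^ (-(1/2):ℝ)) *
         (ENNReal.ofReal (Real.exp (-(s * y)) * y ^ (1/2:ℝ)) * g y ^ 2) =
           (ENNReal.ofReal (√π * y ^ (1/2:ℝ)) * g y ^ 2) * 
            ENNReal.ofReal (s ^ (-(1/2):ℝ) * Real.exp (-(y * s))) := by
          intro s hs
          have hs : 0 < s := hs
          rw [← mul_assoc, ← ENNReal.ofReal_mul (by positivity), mul_right_comm (ENNReal.ofReal (√π * y ^ (1/2:ℝ))), ← ENNReal.ofReal_mul (by positivity)]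
          congr 2
          rw [mul_comm y s]; ring
        rw [setLIntegral_congr_fun measurableSet_Ioi this, lintegral_const_mul _ (by fun_prop), hd_gam hy, mul_right_comm, ← ENNReal.ofReal_mul (by positivity)]
        congr 2
        rw [mul_mul_mul_comm, ← Real.rpow_add hy, Real.mul_self_sqrt pi_pos.le]
        norm_num
    _ = _ := by rw [lintegral_const_mul _ (by fun_prop)]

lemma hd_sq {α E : Type*} [MeasurableSpace α] [NormedAddCommGroup E] (μ : Measure α) (f : α → E) :
    eLpNorm f 2 μ ^ 2 = ∫⁻ x, ‖f x‖ₑ ^ 2 ∂μ := by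
  rw [eLpNorm_eq_lintegral_rpow_enorm_toReal (by norm_num) (by norm_num), ← ENNReal.rpow_two,
    ← ENNReal.rpow_mul]
  simp

lemma hd_lpsq (u : Lp ℂ 2 (volume : Measure ℝ)) : ‖u‖ₑ ^ 2 = ∫⁻ x, ‖u x‖ₑ ^ 2 := by
  rw [← hd_sq, Lp.enorm_def]

lemma hd_normle {u v : Lp ℂ 2 (volume : Measure ℝ)} {c : ℝ} (hc : 0 ≤ c)
    (h : ∫⁻ x, ‖u x‖ₑ ^ 2 ≤ ENNReal.ofReal c * ∫⁻ x, ‖v x‖ₑ ^ 2) : ‖u‖ ≤ √c * ‖v‖ := by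
  rw [← hd_lpsq, ← hd_lpsq, ← ofReal_norm, ← ofReal_norm, ← ENNReal.ofReal_pow (norm_nonneg _),
    ← ENNReal.ofReal_pow (norm_nonneg _), ← ENNReal.ofReal_mul hc,
    ENNReal.ofReal_le_ofReal_iff (by positivity)] at h
  refine abs_le_of_sq_le_sq' ?_ (by positivity) |>.2
  rwa [mul_pow, Real.sq_sqrt hc]

noncomputable def hdL (u : ℝ → ℂ) (s : ℝ) : ℂ :=
  if 0 < s then ∫ y in Set.Ioi (0:ℝ), (Real.exp (-(s * y)) : ℂ) * u y else 0

lemma hdL_sm {u : ℝ → ℂ} (hu : StronglyMeasurable u) : StronglyMeasurable (hdL u) := by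
  unfold hdL
  refine StronglyMeasurable.ite measurableSet_Ioi ?_ stronglyMeasurable_const
  apply StronglyMeasurable.integral_prod_right (f := fun s y : ℝ => (Real.exp (-(s * y)) : ℂ) * u y)
  apply StronglyMeasurable.mul
  · apply Measurable.stronglyMeasurable
    fun_prop
  · exact hu.comp_measurable measurable_snd

lemma hd_schur_abs {u : ℝ → ℂ} (hu : StronglyMeasurable u) :
    ∫⁻ s in Set.Ioi (0:ℝ), (∫⁻ y in Set.Ioi (0:ℝ), ‖(Real.exp (-(s * y)) : ℂ) * u y‖ₑ) ^ 2
      ≤ ENNReal.ofReal π * ∫⁻ y, ‖u y‖ₑ ^ 2 := by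
  have h := hd_schur hu.enorm
  refine le_trans ?_ (h.trans ?_)
  · apply le_of_eq
    congr 1; ext s; congr 2; ext y
    rw [enorm_mul, ← ofReal_norm (Complex.ofReal _), Complex.norm_real, Real.norm_of_nonneg (Real.exp_pos _).le]
  · gcongr
    exact Measure.restrict_le_self

lemma hdL_bound {u : ℝ → ℂ} (hu : StronglyMeasurable u) :
    ∫⁻ s, ‖hdL u s‖ₑ ^ 2 ≤ ENNReal.ofReal π * ∫⁻ y, ‖u y‖ₑ ^ 2 := by
  refine le_trans ?_ (hd_schur_abs hu)
  rw [← lintegral_indicator measurableSet_Ioi]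
  refine lintegral_mono fun s => ?_
  by_cases hs : 0 < s
  · simp only [hdL, hs, if_true, Set.indicator, Set.mem_Ioi]
    gcongr
    exact enorm_integral_le_lintegral_enorm _
  · simp [hdL, hs]

lemma hdL_memLp (u : Lp ℂ 2 (volume : Measure ℝ)) : MemLp (hdL u) 2 volume := by
  refine ⟨(hdL_sm (Lp.stronglyMeasurable u)).aestronglyMeasurable, ?_⟩
  have h := hdL_bound (Lp.stronglyMeasurable u)
  rw [← hd_sq, ← hd_lpsq] at h
  have : eLpNorm (hdL u) 2 volume ^ 2 < ⊤ := lt_of_le_of_lt h (by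
    apply ENNReal.mul_lt_top ENNReal.ofReal_lt_top
    exact ENNReal.pow_lt_top enorm_lt_top)
  simpa using this

lemma hdL_congr {u v : ℝ → ℂ} (h : u =ᵐ[volume] v) : hdL u = hdL v := by
  ext s
  unfold hdL
  congr 1
  apply integral_congr_ae
  filter_upwards [ae_restrict_of_ae h] with y hy
  rw [hy]

lemma hd_expL2 {s : ℝ} (hs : 0 < s) :
    MemLp (fun y : ℝ => (Real.exp (-(s * y)) : ℂ)) 2 (volume.restrict (Set.Ioi 0)) := by
  rw [memLp_two_iff_integrable_sq_norm (by
    apply Measurable.aestronglyMeasurable; fun_prop)]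
  have := exp_neg_integrableOn_Ioi 0 (b := 2 * s) (by positivity)
  refine this.congr (ae_of_all _ fun y => ?_)
  simp only [Complex.norm_real, Real.norm_eq_abs, Real.abs_exp, ← Real.exp_nat_mul]
  congr 1; push_cast; ring

lemma hd_expint (u : Lp ℂ 2 (volume : Measure ℝ)) {s : ℝ} (hs : 0 < s) :
    IntegrableOn (fun y : ℝ => (Real.exp (-(s * y)) : ℂ) * u y) (Set.Ioi 0) :=
  (hd_expL2 hs).integrable_mul ((Lp.memLp u).restrict _)

noncomputable def hdS : (Lp ℂ 2 (volume : Measure ℝ)) →L[ℂ] (Lp ℂ 2 (volume : Measure ℝ)) :=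
  LinearMap.mkContinuous
    { toFun := fun u => (hdL_memLp u).toLp (hdL u)
      map_add' := by
        intro u v
        rw [← MemLp.toLp_add]
        apply MemLp.toLp_congr
        rw [hdL_congr (Lp.coeFn_add u v)]
        refine ae_of_all _ fun s => ?_
        by_cases hs : 0 < s
        · simp only [hdL, hs, if_true, Pi.add_apply, mul_add]
          exact integral_add (hd_expint u hs) (hd_expint v hs)
        · simp [hdL, hs]
      map_smul' := by
        intro c u
        rw [RingHom.id_apply, ← MemLp.toLp_const_smul]
        apply MemLp.toLp_congr
        rw [hdL_congr (Lp.coeFn_smul c u)]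
        refine ae_of_all _ fun s => ?_
        by_cases hs : 0 < s
        · simp only [hdL, hs, if_true, Pi.smul_apply, smul_eq_mul, mul_left_comm _ c]
          exact integral_const_mul _ _
        · simp [hdL, hs] }
    (√π) (by
      intro u
      apply hd_normle pi_pos.le
      refine le_trans (le_of_eq ?_) (hdL_bound (Lp.stronglyMeasurable u))
      apply lintegral_congr_ae
      filter_upwards [(hdL_memLp u).coeFn_toLp] with x hx
      simp only [LinearMap.coe_mk, AddHom.coe_mk, hx])

lemma hdS_coe (u : Lp ℂ 2 (volume : Measure ℝ)) : hdS u =ᵐ[volume] hdL u :=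
  (hdL_memLp u).coeFn_toLp

lemma hdS_norm : ‖hdS‖ ≤ √π := LinearMap.mkContinuous_norm_le _ (by positivity) _

lemma hd_symm_int (u v : Lp ℂ 2 (volume : Measure ℝ)) :
    Integrable (Function.uncurry fun s y : ℝ => (Real.exp (-(s * y)) : ℂ) * u y * v s)
      ((volume.restrict (Set.Ioi 0)).prod (volume.restrict (Set.Ioi 0))) := by
  have hu := Lp.stronglyMeasurable u
  have hv := Lp.stronglyMeasurable v
  have hk : StronglyMeasurable (fun p : ℝ × ℝ => (Real.exp (-(p.1 * p.2)) : ℂ) * u p.2) := by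
    apply StronglyMeasurable.mul
    · apply Measurable.stronglyMeasurable
      fun_prop
    · exact hu.comp_measurable measurable_snd
  have hm : StronglyMeasurable (Function.uncurry fun s y : ℝ => (Real.exp (-(s * y)) : ℂ) * u y * v s) :=
    hk.mul (hv.comp_measurable measurable_fst)
  refine ⟨hm.aestronglyMeasurable, ?_⟩
  rw [HasFiniteIntegral, lintegral_prod _ hm.enorm.aemeasurable]
  simp only [Function.uncurry_apply_pair, enorm_mul _ (v _)]
  have e : ∀ s : ℝ, ∫⁻ y in Set.Ioi (0:ℝ), ‖(Real.exp (-(s * y)) : ℂ) * u y‖ₑ * ‖v s‖ₑ =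
      (∫⁻ y in Set.Ioi (0:ℝ), ‖(Real.exp (-(s * y)) : ℂ) * u y‖ₑ) * ‖v s‖ₑ := fun s =>
    lintegral_mul_const' _ _ enorm_ne_top
  simp only [e]
  have h := hd_cs (volume.restrict (Set.Ioi (0:ℝ)))
    (f := fun s => ∫⁻ y in Set.Ioi (0:ℝ), ‖(Real.exp (-(s * y)) : ℂ) * u y‖ₑ) (g := fun s => ‖v s‖ₑ)
    (Measurable.lintegral_prod_right' hk.enorm).aemeasurable hv.enorm.aemeasurable
  have h1 : ∫⁻ s in Set.Ioi (0:ℝ), (∫⁻ y in Set.Ioi (0:ℝ), ‖(Real.exp (-(s * y)) : ℂ) * u y‖ₑ) ^ 2 < ⊤ := by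
    refine (hd_schur_abs hu).trans_lt ?_
    rw [← hd_lpsq]
    exact ENNReal.mul_lt_top ENNReal.ofReal_lt_top (ENNReal.pow_lt_top enorm_lt_top)
  have h2 : ∫⁻ s in Set.Ioi (0:ℝ), ‖v s‖ₑ ^ 2 < ⊤ := by
    refine (setLIntegral_le_lintegral _ _).trans_lt ?_
    rw [← hd_lpsq]
    exact ENNReal.pow_lt_top enorm_lt_top
  have := h.trans_lt (ENNReal.mul_lt_top h1 h2)
  simpa using this

lemma hdS_sa : IsSelfAdjoint hdS := by
  rw [ContinuousLinearMap.isSelfAdjoint_iff_isSymmetric]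
  intro u v
  simp only [ContinuousLinearMap.coe_coe]
  rw [L2.inner_def, L2.inner_def]
  have hI := hd_symm_int (star u) v
  have e1 : ∫ s, inner ℂ (hdS u s) (v s) = ∫ s in Set.Ioi (0:ℝ), ∫ y in Set.Ioi (0:ℝ),
      (Real.exp (-(s * y)) : ℂ) * (star u : Lp ℂ 2 (volume : Measure ℝ)) y * v s := by
    rw [← integral_indicator measurableSet_Ioi]
    apply integral_congr_ae
    filter_upwards [hdS_coe u] with s hs
    rw [hs]
    by_cases h : 0 < s
    · simp only [hdL, h, if_true, Set.indicator, Set.mem_Ioi, RCLike.inner_apply']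
      rw [← integral_conj, ← integral_mul_const]
      apply integral_congr_ae
      filter_upwards [ae_restrict_of_ae (Lp.coeFn_star u)] with y hy
      rw [hy]
      simp [-Complex.ofReal_exp]
    · simp [hdL, h]
  have e2 : ∫ y, inner ℂ (u y) (hdS v y) = ∫ y in Set.Ioi (0:ℝ), ∫ s in Set.Ioi (0:ℝ),
      (Real.exp (-(s * y)) : ℂ) * (star u : Lp ℂ 2 (volume : Measure ℝ)) y * v s := by
    rw [← integral_indicator measurableSet_Ioi]
    apply integral_congr_ae
    filter_upwards [hdS_coe v, Lp.coeFn_star u] with y hs hu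
    rw [hs]
    by_cases h : 0 < y
    · simp only [hdL, h, hu, if_true, Set.indicator, Set.mem_Ioi, RCLike.inner_apply']
      rw [← integral_const_mul]
      congr 1
      ext s
      rw [mul_comm s y]
      simp [-Complex.ofReal_exp]
      ring
    · simp [hdL, h]
  rw [e1, e2, integral_integral_swap hI]

lemma hd_fub {f : ℝ → ℂ} (hf : StronglyMeasurable f) {x : ℝ} (hx : 0 < x)
    (hi : IntegrableOn (fun y : ℝ => f y / ((x + y : ℝ) : ℂ)) (Set.Ioi 0)) :
    ∫ s in Set.Ioi (0:ℝ), (Real.exp (-(x * s)) : ℂ) * ∫ y in Set.Ioi (0:ℝ), (Real.exp (-(s * y)) : ℂ) * f y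
      = ∫ y in Set.Ioi (0:ℝ), f y / ((x + y : ℝ) : ℂ) := by
  have hm : StronglyMeasurable (Function.uncurry fun s y : ℝ => (Real.exp (-(x + y) * s) : ℂ) * f y) := by
    apply StronglyMeasurable.mul
    · apply Measurable.stronglyMeasurable
      fun_prop
    · exact hf.comp_measurable measurable_snd
  have hint : Integrable (Function.uncurry fun s y : ℝ => (Real.exp (-(x + y) * s) : ℂ) * f y)
      ((volume.restrict (Set.Ioi 0)).prod (volume.restrict (Set.Ioi 0))) := by
    rw [integrable_prod_iff' hm.aestronglyMeasurable]
    constructor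
    · filter_upwards [ae_restrict_mem measurableSet_Ioi] with y hy
      have hy : 0 < y := hy
      exact ((exp_neg_integrableOn_Ioi 0 (add_pos hx hy)).ofReal (𝕜 := ℂ)).mul_const (f y)
    · refine hi.norm.congr ?_
      filter_upwards [ae_restrict_mem measurableSet_Ioi] with y hy
      have hy : 0 < y := hy
      simp only [Function.uncurry_apply_pair, norm_mul, Complex.norm_real, Real.norm_eq_abs, Real.abs_exp, norm_div]
      rw [integral_mul_const, integral_exp_mul_Ioi (by linarith), abs_of_pos (by linarith),
        neg_div_neg_eq, mul_zero, Real.exp_zero]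
      ring
  calc _ = ∫ s in Set.Ioi (0:ℝ), ∫ y in Set.Ioi (0:ℝ), (Real.exp (-(x + y) * s) : ℂ) * f y := by
        congr 1; ext s
        rw [← integral_const_mul]
        congr 1; ext y
        rw [← mul_assoc, ← Complex.ofReal_mul, ← Real.exp_add]
        congr 3; ring
    _ = _ := by
        rw [integral_integral_swap hint]
        refine setIntegral_congr_fun measurableSet_Ioi fun y hy => ?_
        have hy : 0 < y := hy
        beta_reduce
        rw [integral_mul_const, integral_complex_ofReal, integral_exp_mul_Ioi (by linarith)]
        have : ((x + y : ℝ) : ℂ) ≠ 0 := by exact_mod_cast (add_pos hx hy).ne'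
        simp only [mul_zero, Real.exp_zero]
        push_cast at this ⊢
        have h2 : -(y:ℂ) + -x ≠ 0 := by
          intro h; apply this; linear_combination -h
        field_simp
        
lemma hd_invL2 {x : ℝ} (hx : 0 < x) :
    MemLp (fun y : ℝ => (((x + y : ℝ) : ℂ))⁻¹) 2 (volume.restrict (Set.Ioi 0)) := by
  rw [memLp_two_iff_integrable_sq_norm (by
    apply Measurable.aestronglyMeasurable; fun_prop)]
  have h := integrableOn_Ioi_rpow_of_lt (a := -2) (by norm_num) hx
  have h2 : IntegrableOn (fun y : ℝ => (x + y) ^ (-2 : ℝ)) (Set.Ioi 0) := by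
    have := (measurePreserving_add_left volume x).integrableOn_comp_preimage (measurableEmbedding_addLeft x) (f := fun y : ℝ => y ^ (-2:ℝ)) (s := Set.Ioi x)
    have h3 := this.2 h
    simpa [Function.comp_def] using h3
  refine h2.congr ?_
  filter_upwards [ae_restrict_mem measurableSet_Ioi] with y hy
  have hy : 0 < y := hy
  have : 0 < x + y := by positivity
  rw [norm_inv, Complex.norm_real, Real.norm_of_nonneg this.le, Real.rpow_neg this.le]
  simp

lemma hdSS (u : Lp ℂ 2 (volume : Measure ℝ)) : ∀ᵐ x : ℝ, hdS (hdS u) x =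
    if 0 < x then ∫ y in Set.Ioi (0 : ℝ), u y / (((x + y : ℝ) : ℂ)) else 0 := by
  filter_upwards [hdS_coe (hdS u)] with x hx
  rw [hx, hdL_congr (hdS_coe u), hdL]
  split_ifs with h
  · rw [← hd_fub (Lp.stronglyMeasurable u) h]
    · refine setIntegral_congr_fun measurableSet_Ioi fun s hs => ?_
      have hs : 0 < s := hs
      simp only [hdL, hs, if_true]
    · have := (hd_invL2 h).integrable_mul ((Lp.memLp u).restrict (Set.Ioi 0))
      refine this.congr (ae_of_all _ fun y => ?_)
      simp only [Pi.mul_apply, div_eq_mul_inv, mul_comm]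
  · rfl

noncomputable def hdE (ξ : ℝ) (y : ℝ) : ℂ := (y : ℂ) ^ ((1/2 + ξ * Complex.I : ℂ) - 1)

lemma hdE_sm (ξ : ℝ) : StronglyMeasurable (hdE ξ) := by
  apply Measurable.stronglyMeasurable
  unfold hdE
  fun_prop

lemma hdE_norm (ξ : ℝ) {y : ℝ} (hy : 0 < y) : ‖hdE ξ y‖ = y ^ (-(1/2) : ℝ) := by
  rw [hdE, Complex.norm_cpow_eq_rpow_re_of_pos hy]
  congr 1
  simp; norm_num

lemma hdA_bd (ξ : ℝ) {x y : ℝ} (hx : 0 < x) (hy : 0 < y) :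
    ‖hdE ξ y / ((x + y : ℝ) : ℂ)‖ ≤ y ^ (-(1/2) : ℝ) * x⁻¹ := by
  rw [norm_div, hdE_norm ξ hy, Complex.norm_real, Real.norm_of_nonneg (by positivity), div_eq_mul_inv]
  gcongr; linarith

lemma hdB_bd (ξ : ℝ) {x y : ℝ} (hx : 0 < x) (hy : 0 < y) :
    ‖hdE ξ y / ((x + y : ℝ) : ℂ)‖ ≤ y ^ (-(3/2) : ℝ) := by
  rw [norm_div, hdE_norm ξ hy, Complex.norm_real, Real.norm_of_nonneg (by positivity), div_eq_mul_inv]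
  have : y ^ (-(3/2) : ℝ) = y ^ (-(1/2):ℝ) * y⁻¹ := by
    rw [← Real.rpow_neg_one y, ← Real.rpow_add hy]; norm_num
  rw [this]
  gcongr; linarith

lemma hdA_io (x : ℝ) {c : ℝ} (hc : 0 ≤ c) :
    IntegrableOn (fun y : ℝ => y ^ (-(1/2) : ℝ) * x⁻¹) (Set.Ioc 0 c) := by
  apply Integrable.mul_const
  have := intervalIntegral.intervalIntegrable_rpow' (a := 0) (b := c) (r := -(1/2)) (by norm_num)
  rwa [intervalIntegrable_iff_integrableOn_Ioc_of_le hc] at this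

lemma hdA (ξ : ℝ) {x c : ℝ} (hx : 0 < x) (hc : 0 < c) {s : Set ℝ} (hs : MeasurableSet s)
    (hsc : s ⊆ Set.Ioc 0 c) :
    ‖∫ y in s, hdE ξ y / ((x + y : ℝ) : ℂ)‖ ≤ 2 * √c / x := by
  have hi := hdA_io x hc.le
  calc _ ≤ ∫ y in s, y ^ (-(1/2) : ℝ) * x⁻¹ := by
        apply norm_integral_le_of_norm_le (hi.mono_set hsc)
        filter_upwards [ae_restrict_mem hs] with y hy
        exact hdA_bd ξ hx (hsc hy).1
    _ ≤ ∫ y in Set.Ioc 0 c, y ^ (-(1/2) : ℝ) * x⁻¹ := by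
        apply setIntegral_mono_set hi _ (Filter.Eventually.of_forall hsc)
        filter_upwards [ae_restrict_mem measurableSet_Ioc] with y hy
        have := hy.1
        simp only [Pi.zero_apply]; positivity
    _ = _ := by
        rw [integral_mul_const, ← intervalIntegral.integral_of_le hc.le,
          integral_rpow (Or.inl (by norm_num)), Real.sqrt_eq_rpow]
        norm_num
        field_simp

lemma hdB (ξ : ℝ) {x c : ℝ} (hx : 0 < x) (hc : 0 < c) {s : Set ℝ} (hs : MeasurableSet s)
    (hsc : s ⊆ Set.Ioi c) :
    ‖∫ y in s, hdE ξ y / ((x + y : ℝ) : ℂ)‖ ≤ 2 * (√c)⁻¹ := by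
  have hi := integrableOn_Ioi_rpow_of_lt (a := -(3/2)) (by norm_num) hc
  calc _ ≤ ∫ y in s, y ^ (-(3/2) : ℝ) := by
        apply norm_integral_le_of_norm_le (hi.mono_set hsc)
        filter_upwards [ae_restrict_mem hs] with y hy
        exact hdB_bd ξ hx (hc.trans (hsc hy))
    _ ≤ ∫ y in Set.Ioi c, y ^ (-(3/2) : ℝ) := by
        apply setIntegral_mono_set hi _ (Filter.Eventually.of_forall hsc)
        filter_upwards [ae_restrict_mem measurableSet_Ioi] with y hy
        have : 0 < y := hc.trans hy
        simp only [Pi.zero_apply]; positivity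
    _ = _ := by
        rw [integral_Ioi_rpow_of_lt (by norm_num) hc, Real.sqrt_eq_rpow, ← Real.rpow_neg hc.le]
        norm_num
        ring

lemma hdE_int (ξ : ℝ) {x : ℝ} (hx : 0 < x) :
    IntegrableOn (fun y : ℝ => hdE ξ y / ((x + y : ℝ) : ℂ)) (Set.Ioi 0) := by
  have hm : Measurable (fun y : ℝ => hdE ξ y / ((x + y : ℝ) : ℂ)) := by
    have := (hdE_sm ξ).measurable
    fun_prop
  rw [← Set.Ioc_union_Ioi_eq_Ioi (zero_le_one' ℝ)]
  apply IntegrableOn.union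
  · apply Integrable.mono' (hdA_io x zero_le_one) hm.aestronglyMeasurable
    filter_upwards [ae_restrict_mem measurableSet_Ioc] with y hy
    exact hdA_bd ξ hx hy.1
  · apply Integrable.mono' (integrableOn_Ioi_rpow_of_lt (a := -(3/2)) (by norm_num) one_pos) hm.aestronglyMeasurable
    filter_upwards [ae_restrict_mem measurableSet_Ioi] with y hy
    exact hdB_bd ξ hx (one_pos.trans hy)

lemma hdE_mellin (ξ : ℝ) {x : ℝ} (hx : 0 < x) :
    ∫ y in Set.Ioi (0:ℝ), hdE ξ y / ((x + y : ℝ) : ℂ) =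
      (π : ℂ) * ((Real.cosh (π * ξ))⁻¹ : ℝ) * hdE ξ x := by
  rw [← hd_fub (hdE_sm ξ) hx (hdE_int ξ hx)]
  set a : ℂ := 1/2 + ξ * Complex.I with ha
  have hre : a.re = 1/2 := by simp [ha]
  have h1 : ∀ s ∈ Set.Ioi (0:ℝ), (Real.exp (-(x * s)) : ℂ) *
      ∫ y in Set.Ioi (0:ℝ), (Real.exp (-(s * y)) : ℂ) * hdE ξ y =
      Complex.Gamma a * ((s:ℂ) ^ ((1 - a) - 1) * Complex.exp (-(x * s))) := by
    intro s hs
    have hs : 0 < s := hs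
    have := Complex.integral_cpow_mul_exp_neg_mul_Ioi (a := a) (r := s) (by rw [hre]; norm_num) hs
    have e : ∫ y in Set.Ioi (0:ℝ), (Real.exp (-(s * y)) : ℂ) * hdE ξ y =
        ∫ (t : ℝ) in Set.Ioi 0, (t:ℂ) ^ (a - 1) * Complex.exp (-(s * t)) := by
      congr 1; ext y; rw [hdE]; push_cast; ring
    rw [e, this]
    have e2 : (1 / (s:ℂ)) ^ a = (s:ℂ) ^ ((1 - a) - 1) := by
      rw [one_div, Complex.inv_cpow, ← Complex.cpow_neg]
      · congr 1; ring
      · rw [Complex.arg_ofReal_of_nonneg hs.le]; exact pi_pos.ne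
    rw [e2]; push_cast; ring
  rw [setIntegral_congr_fun measurableSet_Ioi h1, integral_const_mul,
    Complex.integral_cpow_mul_exp_neg_mul_Ioi (by rw [Complex.sub_re, hre]; norm_num) hx]
  have e2 : (1 / (x:ℂ)) ^ (1 - a) = hdE ξ x := by
    rw [one_div, Complex.inv_cpow, ← Complex.cpow_neg, hdE, ← ha]
    · congr 1; ring
    · rw [Complex.arg_ofReal_of_nonneg hx.le]; exact pi_pos.ne
  rw [e2, mul_left_comm, Complex.Gamma_mul_Gamma_one_sub, mul_comm]
  congr 1
  have : Complex.sin (π * a) = Real.cosh (π * ξ) := by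
    rw [ha, mul_add, add_comm, show (π:ℂ) * (1/2) = π/2 by ring, Complex.sin_add_pi_div_two,
      ← mul_assoc, Complex.cos_mul_I]
    push_cast; rfl
  rw [this, div_eq_mul_inv]
  push_cast; rfl

noncomputable def hdU (ξ R : ℝ) : ℝ → ℂ := (Set.Ioc 1 R).indicator (hdE ξ)

noncomputable def hdM (R : ℝ) (x : ℝ) : ℝ :=
  (Set.Ioc 0 1).indicator (fun _ => 4) x + (Set.Ioi 1).indicator (fun x => 8 * x ^ (-2:ℝ)) x
  + (Set.Ioc 0 R).indicator (fun _ => 8 / R) x + (Set.Ioi R).indicator (fun x => 4 * R * x ^ (-2:ℝ)) x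

lemma hdM_nonneg {R : ℝ} (hR : 1 ≤ R) (x : ℝ) : 0 ≤ hdM R x := by
  unfold hdM
  have : ∀ x ∈ Set.Ioi (1:ℝ), 0 ≤ 8 * x ^ (-2:ℝ) := fun x hx => by
    have : 0 < x := one_pos.trans hx
    positivity
  have : ∀ x ∈ Set.Ioi R, 0 ≤ 4 * R * x ^ (-2:ℝ) := fun x hx => by
    have : 0 < x := lt_of_lt_of_le one_pos (hR.trans (le_of_lt hx))
    positivity
  have := Set.indicator_nonneg (s := Set.Ioc (0:ℝ) 1) (f := fun _ => (4:ℝ)) (by intros; norm_num) x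
  have := Set.indicator_nonneg (s := Set.Ioc (0:ℝ) R) (f := fun _ => (8 / R:ℝ)) (by intros; positivity) x
  have := Set.indicator_nonneg (s := Set.Ioi (1:ℝ)) (f := fun x => 8 * x ^ (-2:ℝ)) (by assumption) x
  have := Set.indicator_nonneg (s := Set.Ioi R) (f := fun x => 4 * R * x ^ (-2:ℝ)) (by assumption) x
  positivity

lemma hdM_int {R : ℝ} (hR : 1 ≤ R) : ∫⁻ x, ENNReal.ofReal (hdM R x) = ENNReal.ofReal 24 := by
  have hR0 : 0 < R := by linarith
  have i1 : Integrable ((Set.Ioc (0:ℝ) 1).indicator (fun _ => (4:ℝ))) :=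
    (integrable_indicator_iff measurableSet_Ioc).2 (integrableOn_const (by simp))
  have i2 : Integrable ((Set.Ioi (1:ℝ)).indicator (fun x => 8 * x ^ (-2:ℝ))) :=
    (integrable_indicator_iff measurableSet_Ioi).2
      ((integrableOn_Ioi_rpow_of_lt (by norm_num) one_pos).const_mul _)
  have i3 : Integrable ((Set.Ioc (0:ℝ) R).indicator (fun _ => (8 / R:ℝ))) :=
    (integrable_indicator_iff measurableSet_Ioc).2 (integrableOn_const (by simp))
  have i4 : Integrable ((Set.Ioi R).indicator (fun x => 4 * R * x ^ (-2:ℝ))) :=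
    (integrable_indicator_iff measurableSet_Ioi).2
      ((integrableOn_Ioi_rpow_of_lt (by norm_num) hR0).const_mul _)
  rw [← ofReal_integral_eq_lintegral_ofReal (f := hdM R) (((i1.add i2).add i3).add i4)
    (ae_of_all _ (hdM_nonneg hR))]
  congr 1
  have hM : hdM R = (Set.Ioc (0:ℝ) 1).indicator (fun _ => (4:ℝ)) +
      (Set.Ioi (1:ℝ)).indicator (fun x => 8 * x ^ (-2:ℝ)) +
      (Set.Ioc (0:ℝ) R).indicator (fun _ => (8 / R:ℝ)) +
      (Set.Ioi R).indicator (fun x => 4 * R * x ^ (-2:ℝ)) := rfl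
  rw [hM, integral_add' ((i1.add i2).add i3) i4, integral_add' (i1.add i2) i3, integral_add' i1 i2,
    integral_indicator measurableSet_Ioc, integral_indicator measurableSet_Ioc,
    integral_indicator measurableSet_Ioi, integral_indicator measurableSet_Ioi,
    integral_const_mul, integral_const_mul, integral_Ioi_rpow_of_lt (by norm_num) one_pos,
    integral_Ioi_rpow_of_lt (by norm_num) hR0]
  have : R ^ (-2 + 1 : ℝ) = R⁻¹ := by
    rw [← Real.rpow_neg_one]; norm_num
  rw [this]
  simp [hR0.le]
  field_simp
  norm_num

lemma hdU_err (ξ : ℝ) {R : ℝ} (hR : 1 ≤ R) {x : ℝ} (hx : 0 < x) :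
    ‖(∫ y in Set.Ioi (0:ℝ), hdU ξ R y / ((x + y : ℝ) : ℂ)) -
      (π : ℂ) * ((Real.cosh (π * ξ))⁻¹ : ℝ) * hdU ξ R x‖ ^ 2 ≤ hdM R x := by
  have hR0 : 0 < R := by linarith
  have e : ∫ y in Set.Ioi (0:ℝ), hdU ξ R y / ((x + y : ℝ) : ℂ) =
      ∫ y in Set.Ioc 1 R, hdE ξ y / ((x + y : ℝ) : ℂ) := by
    have : ∀ y, hdU ξ R y / ((x + y : ℝ) : ℂ) =
       (Set.Ioc 1 R).indicator (fun y => hdE ξ y / ((x + y : ℝ) : ℂ)) y := by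
      intro y
      by_cases h : y ∈ Set.Ioc 1 R <;> simp [hdU, h]
    simp only [this]
    rw [setIntegral_indicator measurableSet_Ioc, Set.inter_eq_right.2]
    intro y hy
    exact one_pos.trans hy.1
  rw [e]
  have hx2 : x ^ (-2:ℝ) = (x⁻¹) ^ 2 := by
    rw [Real.rpow_neg hx.le]; simp
  rcases le_or_gt x 1 with h1 | h1
  · have hu : hdU ξ R x = 0 := by simp [hdU, h1]
    have hb := hdB ξ hx one_pos measurableSet_Ioc (s := Set.Ioc 1 R) (fun y hy => hy.1)
    have : hdM R x = 4 + 8 / R := by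
      simp [hdM, hx, h1, h1.trans hR]
    rw [hu, this, mul_zero, sub_zero]
    have h0 : 0 ≤ 8 / R := by positivity
    simp only [Real.sqrt_one, inv_one, mul_one] at hb
    nlinarith [norm_nonneg (∫ y in Set.Ioc 1 R, hdE ξ y / ((x + y : ℝ) : ℂ))]
  rcases le_or_gt x R with h2 | h2
  · have hu : hdU ξ R x = hdE ξ x := by simp [hdU, h1, h2]
    have hi := hdE_int ξ hx
    have hs1 : ∫ y in Set.Ioi (0:ℝ), hdE ξ y / ((x + y : ℝ) : ℂ) =
        (∫ y in Set.Ioc 0 1, hdE ξ y / ((x + y : ℝ) : ℂ)) +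
        ((∫ y in Set.Ioc 1 R, hdE ξ y / ((x + y : ℝ) : ℂ)) +
         ∫ y in Set.Ioi R, hdE ξ y / ((x + y : ℝ) : ℂ)) := by
      rw [← setIntegral_union (Set.Ioc_disjoint_Ioi le_rfl) measurableSet_Ioi
        (hi.mono_set (fun y hy => Set.mem_Ioi.2 (one_pos.trans hy.1))) (hi.mono_set (Set.Ioi_subset_Ioi hR0.le)),
        Set.Ioc_union_Ioi_eq_Ioi hR,
        ← setIntegral_union (Set.Ioc_disjoint_Ioi le_rfl) measurableSet_Ioi
        (hi.mono_set (fun y hy => hy.1)) (hi.mono_set (Set.Ioi_subset_Ioi zero_le_one)),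
        Set.Ioc_union_Ioi_eq_Ioi zero_le_one]
    rw [hu, ← hdE_mellin ξ hx, hs1]
    have ha := hdA ξ hx one_pos (measurableSet_Ioc (a := (0:ℝ)) (b := 1)) subset_rfl
    have hb := hdB ξ hx hR0 (measurableSet_Ioi (a := R)) subset_rfl
    have : hdM R x = 8 * (x⁻¹) ^ 2 + 8 / R := by
      rw [← hx2]
      simp [hdM, hx, h1, h2]
    rw [this]
    set A := ∫ y in Set.Ioc 0 1, hdE ξ y / ((x + y : ℝ) : ℂ)
    set C := ∫ y in Set.Ioi R, hdE ξ y / ((x + y : ℝ) : ℂ)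
    set B := ∫ y in Set.Ioc 1 R, hdE ξ y / ((x + y : ℝ) : ℂ)
    have e3 : B - (A + (B + C)) = -(A + C) := by ring
    rw [e3, norm_neg]
    have hn : ‖A + C‖ ≤ 2 * x⁻¹ + 2 * (√R)⁻¹ := by
      refine (norm_add_le _ _).trans (add_le_add ?_ hb)
      simpa [div_eq_mul_inv] using ha
    have h8 : 8 / R = 8 * ((√R)⁻¹) ^ 2 := by
      rw [inv_pow, Real.sq_sqrt hR0.le]; ring
    rw [h8]
    calc ‖A + C‖ ^ 2 ≤ (2 * x⁻¹ + 2 * (√R)⁻¹) ^ 2 := by gcongr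
      _ ≤ _ := by nlinarith [sq_nonneg (x⁻¹ - (√R)⁻¹)]
  · have hu : hdU ξ R x = 0 := by simp [hdU, h2]
    have ha := hdA ξ hx hR0 measurableSet_Ioc (s := Set.Ioc 1 R)
      (fun y hy => ⟨one_pos.trans hy.1, hy.2⟩)
    have : hdM R x = 8 * (x⁻¹) ^ 2 + 4 * R * (x⁻¹) ^ 2 := by
      rw [← hx2]
      simp [hdM, h1, h2]
    rw [hu, this, mul_zero, sub_zero]
    calc _ ≤ (2 * √R / x) ^ 2 := by gcongr
      _ = 4 * R * (x⁻¹) ^ 2 := by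
        rw [div_pow, mul_pow, Real.sq_sqrt hR0.le]; field_simp; norm_num
      _ ≤ _ := by
        have : 0 ≤ 8 * (x⁻¹) ^ 2 := by positivity
        linarith

lemma hdU_norm (ξ : ℝ) {R : ℝ} (hR : 1 ≤ R) :
    ∫⁻ x, ‖hdU ξ R x‖ₑ ^ 2 = ENNReal.ofReal (Real.log R) := by
  have hR0 : 0 < R := by linarith
  have h1 : ∀ x, ‖hdU ξ R x‖ₑ ^ 2 = (Set.Ioc 1 R).indicator (fun x => ENNReal.ofReal (1 / x)) x := by
    intro x
    by_cases h : x ∈ Set.Ioc 1 R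
    · have hx : 0 < x := one_pos.trans h.1
      simp only [hdU, h, Set.indicator_of_mem]
      rw [← ofReal_norm, hdE_norm ξ hx, ← ENNReal.ofReal_pow (by positivity), ← Real.rpow_mul_natCast hx.le]
      congr 1
      norm_num [Real.rpow_neg_one]
    · simp [hdU, h]
  simp only [h1]
  rw [lintegral_indicator measurableSet_Ioc, ← ofReal_integral_eq_lintegral_ofReal,
    ← intervalIntegral.integral_of_le hR, integral_one_div_of_pos one_pos hR0, div_one]
  · rw [← IntegrableOn, ← intervalIntegrable_iff_integrableOn_Ioc_of_le hR]
    apply intervalIntegral.intervalIntegrable_one_div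
    · intro x hx
      rw [Set.uIcc_of_le hR] at hx
      linarith [hx.1]
    · fun_prop
  · filter_upwards [ae_restrict_mem measurableSet_Ioc] with x hx
    have : 0 < x := one_pos.trans hx.1
    simp only [Pi.zero_apply]; positivity

lemma hdU_memLp (ξ : ℝ) {R : ℝ} (hR : 1 ≤ R) : MemLp (hdU ξ R) 2 volume := by
  refine ⟨((hdE_sm ξ).indicator measurableSet_Ioc).aestronglyMeasurable, ?_⟩
  have h := hd_sq volume (hdU ξ R)
  rw [hdU_norm ξ hR] at h
  have : eLpNorm (hdU ξ R) 2 volume ^ 2 < ⊤ := by rw [h]; exact ENNReal.ofReal_lt_top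
  simpa using this

noncomputable def hdT : (Lp ℂ 2 (volume : Measure ℝ)) →L[ℂ] (Lp ℂ 2 (volume : Measure ℝ)) :=
  ((π : ℂ)⁻¹) • (hdS * hdS)

lemma hdT_coe (u : Lp ℂ 2 (volume : Measure ℝ)) : ∀ᵐ x : ℝ, hdT u x =
    if 0 < x then (π : ℂ)⁻¹ * ∫ y in Set.Ioi (0 : ℝ), u y / (((x + y : ℝ) : ℂ)) else 0 := by
  have h : hdT u = ((π : ℂ)⁻¹) • (hdS (hdS u)) := rfl
  rw [h]
  filter_upwards [Lp.coeFn_smul ((π : ℂ)⁻¹) (hdS (hdS u)), hdSS u] with x h1 h2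
  rw [h1, Pi.smul_apply, h2]
  split_ifs <;> simp

lemma hdT_approx (ξ : ℝ) {R : ℝ} (hR : 1 ≤ R) :
    ∫⁻ x, ‖(hdT ((hdU_memLp ξ hR).toLp _) -
      (((Real.cosh (π * ξ))⁻¹ : ℝ) : ℂ) • ((hdU_memLp ξ hR).toLp _) : Lp ℂ 2 (volume : Measure ℝ)) x‖ₑ ^ 2
      ≤ ENNReal.ofReal 24 := by
  rw [← hdM_int hR]
  apply lintegral_mono_ae
  set u := (hdU_memLp ξ hR).toLp _ with hu
  have hcu : u =ᵐ[volume] hdU ξ R := (hdU_memLp ξ hR).coeFn_toLp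
  filter_upwards [hdT_coe u, hcu, Lp.coeFn_sub (hdT u) ((((Real.cosh (π * ξ))⁻¹ : ℝ) : ℂ) • u),
    Lp.coeFn_smul ((((Real.cosh (π * ξ))⁻¹ : ℝ) : ℂ)) u] with x h1 h2 h3 h4
  rw [h3, Pi.sub_apply, h4, Pi.smul_apply, h1, h2, ← ofReal_norm, ← ENNReal.ofReal_pow (norm_nonneg _)]
  apply ENNReal.ofReal_le_ofReal
  split_ifs with hx
  · have e : ∫ y in Set.Ioi (0 : ℝ), u y / (((x + y : ℝ) : ℂ)) =
       ∫ y in Set.Ioi (0 : ℝ), hdU ξ R y / (((x + y : ℝ) : ℂ)) := by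
      apply integral_congr_ae
      filter_upwards [ae_restrict_of_ae hcu] with y hy
      rw [hy]
    rw [e]
    refine le_trans ?_ (hdU_err ξ hR hx)
    have hpi : (π : ℂ) ≠ 0 := by exact_mod_cast pi_ne_zero
    set I := ∫ y in Set.Ioi (0 : ℝ), hdU ξ R y / (((x + y : ℝ) : ℂ))
    have e2 : (π:ℂ)⁻¹ * I - (((Real.cosh (π * ξ))⁻¹ : ℝ) : ℂ) • hdU ξ R x =
      (π:ℂ)⁻¹ * (I - (π : ℂ) * ((Real.cosh (π * ξ))⁻¹ : ℝ) * hdU ξ R x) := by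
      rw [smul_eq_mul]; field_simp
    rw [e2, norm_mul, norm_inv, Complex.norm_real, Real.norm_of_nonneg pi_pos.le]
    gcongr
    apply mul_le_of_le_one_left (norm_nonneg _)
    apply inv_le_one_of_one_le₀
    linarith [pi_gt_three]
  · have : hdU ξ R x = 0 := by
      rw [hdU, Set.indicator_of_notMem]
      intro h; exact hx (one_pos.trans h.1)
    rw [this]
    simpa using hdM_nonneg hR x

lemma hdT_spec (ξ : ℝ) : (((Real.cosh (π * ξ))⁻¹ : ℝ) : ℂ) ∈ spectrum ℂ hdT := by
  by_contra hn
  rw [spectrum.notMem_iff, ← IsUnit.neg_iff] at hn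
  obtain ⟨V, hV⟩ := hn
  set l : ℂ := (((Real.cosh (π * ξ))⁻¹ : ℝ) : ℂ) with hl
  set W : (Lp ℂ 2 (volume : Measure ℝ)) →L[ℂ] (Lp ℂ 2 (volume : Measure ℝ)) := ↑V⁻¹ with hW
  have hb : ∀ u : Lp ℂ 2 (volume : Measure ℝ), ‖u‖ ≤ ‖W‖ * ‖hdT u - l • u‖ := by
    intro u
    have h1 : W * (V : (Lp ℂ 2 (volume : Measure ℝ)) →L[ℂ] (Lp ℂ 2 (volume : Measure ℝ))) = 1 := V.inv_mul
    have h2 : W (hdT u - l • u) = u := by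
      have h3 : hdT u - l • u = (V : (Lp ℂ 2 (volume : Measure ℝ)) →L[ℂ] (Lp ℂ 2 (volume : Measure ℝ))) u := by
        rw [hV]
        simp [Algebra.algebraMap_eq_smul_one]
      rw [h3, ← ContinuousLinearMap.mul_apply, h1]
      rfl
    calc ‖u‖ = ‖W (hdT u - l • u)‖ := by rw [h2]
      _ ≤ _ := W.le_opNorm _
  have hlog : ∀ R : ℝ, 1 ≤ R → Real.log R ≤ ‖W‖ ^ 2 * 24 := by
    intro R hR
    have h1 := hb ((hdU_memLp ξ hR).toLp _)
    have h2 := hdT_approx ξ hR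
    have h3 : ‖((hdU_memLp ξ hR).toLp _ : Lp ℂ 2 (volume : Measure ℝ))‖ₑ ^ 2 = ENNReal.ofReal (Real.log R) := by
      rw [Lp.enorm_toLp, hd_sq, hdU_norm ξ hR]
    rw [← hd_lpsq, ← ofReal_norm, ← ENNReal.ofReal_pow (norm_nonneg _),
      ENNReal.ofReal_le_ofReal_iff (by norm_num)] at h2
    rw [← ofReal_norm, ← ENNReal.ofReal_pow (norm_nonneg _),
      ENNReal.ofReal_eq_ofReal_iff (by positivity) (Real.log_nonneg hR)] at h3
    rw [← h3]
    calc _ ≤ (‖W‖ * ‖hdT ((hdU_memLp ξ hR).toLp _) - l • ((hdU_memLp ξ hR).toLp _)‖) ^ 2 := by gcongr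
      _ = ‖W‖ ^ 2 * ‖hdT ((hdU_memLp ξ hR).toLp _) - l • ((hdU_memLp ξ hR).toLp _)‖ ^ 2 := mul_pow _ _ _
      _ ≤ _ := by gcongr
  have := hlog (Real.exp (‖W‖ ^ 2 * 24 + 1)) (Real.one_le_exp (by positivity))
  rw [Real.log_exp] at this
  linarith

lemma hdT_sa : IsSelfAdjoint hdT := by
  have h := hdS_sa
  unfold hdT
  have h2 : IsSelfAdjoint (hdS * hdS) := by
    rw [IsSelfAdjoint, star_mul, h.star_eq]
  apply IsSelfAdjoint.smul _ h2
  rw [IsSelfAdjoint, star_inv₀]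
  simp

lemma hdT_norm_le : ‖hdT‖ ≤ 1 := by
  unfold hdT
  rw [norm_smul, norm_inv, Complex.norm_real, Real.norm_of_nonneg pi_pos.le]
  have h1 : ‖hdS * hdS‖ ≤ √π * √π := (norm_mul_le _ _).trans (by gcongr <;> exact hdS_norm)
  rw [Real.mul_self_sqrt pi_pos.le] at h1
  rw [inv_mul_le_iff₀ pi_pos, mul_one]
  exact h1

lemma hdT_mem {t : ℝ} (h0 : 0 < t) (h1 : t ≤ 1) : (t : ℂ) ∈ spectrum ℂ hdT := by
  have := hdT_spec (Real.arcosh t⁻¹ / π)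
  rwa [mul_div_cancel₀ _ pi_ne_zero, Real.cosh_arcosh ((one_le_inv₀ h0).2 h1), inv_inv] at this

lemma hdT_nonneg {t : ℝ} (h : (t : ℂ) ∈ spectrum ℂ hdT) : 0 ≤ t := by
  have h' : t ∈ spectrum ℝ hdT := (spectrum.algebraMap_mem_iff ℂ).1 h
  have e : hdT = star ((((√π)⁻¹ : ℝ) : ℂ) • hdS) * ((((√π)⁻¹ : ℝ) : ℂ) • hdS) := by
    rw [star_smul, hdS_sa.star_eq, smul_mul_smul_comm]
    unfold hdT
    congr 1
    rw [Complex.star_def, Complex.conj_ofReal, ← Complex.ofReal_mul, ← mul_inv, Real.mul_self_sqrt pi_pos.le]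
    push_cast; rfl
  rw [e] at h'
  exact spectrum_star_mul_self_nonneg t h'

/-- The Hardy operator `(Tu)(x) = (1/π) ∫_0^∞ u(y)/(x+y) dy` for `x > 0` (and `0` for `x ≤ 0`)
is a bounded self-adjoint operator on `L²(ℝ)` with operator norm `1` and spectrum `[0,1]`. -/
theorem hardy_operator_selfAdjoint_norm_one_spectrum :
    ∃ T : (Lp ℂ 2 (volume : Measure ℝ)) →L[ℂ] (Lp ℂ 2 (volume : Measure ℝ)),
      (∀ u : Lp ℂ 2 (volume : Measure ℝ), ∀ᵐ x : ℝ,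
        T u x = if 0 < x then
            ((Real.pi : ℂ))⁻¹ * ∫ y in Set.Ioi (0 : ℝ), u y / (((x + y : ℝ) : ℂ))
          else 0) ∧
      IsSelfAdjoint T ∧ ‖T‖ = 1 ∧
      spectrum ℂ T = Complex.ofReal '' Set.Icc (0 : ℝ) 1 := by
  have hm1 := hdT_mem one_pos le_rfl
  have hne : Nontrivial (Lp ℂ 2 (volume : Measure ℝ)) := by
    by_contra h
    rw [not_nontrivial_iff_subsingleton] at h
    have : Subsingleton ((Lp ℂ 2 (volume : Measure ℝ)) →L[ℂ] (Lp ℂ 2 (volume : Measure ℝ))) :=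
      ⟨fun a b => by ext1 u; exact Subsingleton.elim _ _⟩
    rw [spectrum.of_subsingleton] at hm1
    exact hm1
  refine ⟨hdT, hdT_coe, hdT_sa, le_antisymm hdT_norm_le ?_, ?_⟩
  · simpa using spectrum.norm_le_norm_of_mem hm1
  · apply Set.Subset.antisymm
    · intro z hz
      have hr := hdT_sa.mem_spectrum_eq_re hz
      rw [hr] at hz
      refine ⟨z.re, ⟨hdT_nonneg hz, ?_⟩, hr.symm⟩
      have := (spectrum.norm_le_norm_of_mem hz).trans hdT_norm_le
      rw [Complex.norm_real] at this
      exact (le_abs_self _).trans this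
    · have hcl : IsClosed (Complex.ofReal ⁻¹' (spectrum ℂ hdT)) :=
        (spectrum.isClosed hdT).preimage Complex.continuous_ofReal
      have hsub : Set.Ioc (0:ℝ) 1 ⊆ Complex.ofReal ⁻¹' (spectrum ℂ hdT) :=
        fun t ht => hdT_mem ht.1 ht.2
      have := closure_minimal hsub hcl
      rw [closure_Ioc (by norm_num)] at this
      exact Set.image_subset_iff.2 this
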